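/- Let C_m = max{1, C₁, 4πC₂}. There exists δ₀ > 0, depending only on L₀, C₁, C₂ and q, such that for every reduced static shell with inner radius R₀ ≤ δ₀ and for every δ with 0 < δ ≤ R₀^((q+3)/(q+1))/(C_m · 8^(1/(q+1))), one has γ(R₀ + σ) ≥ σ/(2(R₀ + σ)) for all σ ∈ [0, δ]. -/

import Mathlib

open Real MeasureTheory

noncomputable section

/-- `γ(r) = -μ(r) - (1/2)·log(1 + L₀/r²)`. -/
def gam (L₀ : ℝ) (μ : ℝ → ℝ) (r : ℝ) : ℝ :=
  -μ r - (1 / 2) * Real.log (1 + L₀ / r ^ 2)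

/-- Energy density `ρ(r) = C₁·max(γ(r),0)^q / r⁴`. -/
def rho (L₀ C₁ q : ℝ) (μ : ℝ → ℝ) (r : ℝ) : ℝ :=
  C₁ * (max (gam L₀ μ r) 0) ^ q / r ^ 4

/-- Radial pressure `p(r) = C₂·max(γ(r),0)^(q+1) / r⁴`. -/
def pres (L₀ C₂ q : ℝ) (μ : ℝ → ℝ) (r : ℝ) : ℝ :=
  C₂ * (max (gam L₀ μ r) 0) ^ (q + 1) / r ^ 4

/-- `z(r) = C₃·max(γ(r),0)^q / r²`. -/
def zfun (L₀ C₃ q : ℝ) (μ : ℝ → ℝ) (r : ℝ) : ℝ :=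
  C₃ * (max (gam L₀ μ r) 0) ^ q / r ^ 2

/-- Quasi-local mass `m(r) = ∫_{R₀}^r 4π η² ρ(η) dη`. -/
def mass (R₀ L₀ C₁ q : ℝ) (μ : ℝ → ℝ) (r : ℝ) : ℝ :=
  ∫ η in R₀..r, 4 * π * η ^ 2 * rho L₀ C₁ q μ η

/-- `μ'(r) = (m/r² + 4πrp)·e^{2λ}` with `e^{-2λ} = 1 - 2m/r`. -/
def muder (R₀ L₀ C₁ C₂ q : ℝ) (μ : ℝ → ℝ) (r : ℝ) : ℝ :=
  (mass R₀ L₀ C₁ q μ r / r ^ 2 + 4 * π * r * pres L₀ C₂ q μ r) *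
    (1 - 2 * mass R₀ L₀ C₁ q μ r / r)⁻¹

/-- `γ'(r) = -μ'(r) + L₀/(r(r²+L₀))`. -/
def gamder (R₀ L₀ C₁ C₂ q : ℝ) (μ : ℝ → ℝ) (r : ℝ) : ℝ :=
  -muder R₀ L₀ C₁ C₂ q μ r + L₀ / (r * (r ^ 2 + L₀))

/-- A reduced static shell: `γ(R₀)=0`, `2m(r)/r<1` for `r ≥ R₀`, and the
field equation `μ'(r) = (m/r² + 4πrp)·(1-2m/r)⁻¹` for `r ≥ R₀`. -/
structure IsReducedShell (R₀ L₀ C₁ C₂ q : ℝ) (μ : ℝ → ℝ) : Prop where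
  inner_zero : gam L₀ μ R₀ = 0
  mass_lt : ∀ r, R₀ ≤ r → 2 * mass R₀ L₀ C₁ q μ r / r < 1
  field_eq : ∀ r, R₀ ≤ r → HasDerivAt μ (muder R₀ L₀ C₁ C₂ q μ r) r

lemma hd_congr {f f2 : ℝ → ℝ} {d d2 t : ℝ} (h : HasDerivAt f d t) (hf : ∀ s, f2 s = f s)
    (hd : d2 = d) : HasDerivAt f2 d2 t := by
  have e : f2 = f := funext hf
  rw [e, hd]; exact h

lemma anti_aux {f f' : ℝ → ℝ} {a b : ℝ} (hab : a ≤ b) (hc : ContinuousOn f (Set.Icc a b))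
    (hd : ∀ t ∈ Set.Ioo a b, HasDerivAt f (f' t) t) (hn : ∀ t ∈ Set.Ioo a b, f' t ≤ 0) :
    f b ≤ f a := by
  have h : AntitoneOn f (Set.Icc a b) := by
    apply antitoneOn_of_deriv_nonpos (convex_Icc a b) hc
    · rw [interior_Icc]
      intro t ht
      exact (hd t ht).differentiableAt.differentiableWithinAt
    · rw [interior_Icc]
      intro t ht
      rw [(hd t ht).deriv]
      exact hn t ht
  exact h (Set.left_mem_Icc.2 hab) (Set.right_mem_Icc.2 hab) hab

/-- cubic minorant of `x/(1-2x)` -/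
def PP (y : ℝ) : ℝ := y + 2 * y ^ 2 + 4 * y ^ 3

lemma PP_mono {y z : ℝ} (h : y ≤ z) : PP y ≤ PP z := by
  unfold PP
  nlinarith [mul_nonneg (sub_nonneg.2 h) (by nlinarith [sq_nonneg (y + z + 1/2), sq_nonneg (y+z), sq_nonneg y, sq_nonneg z] :
    0 ≤ 1 + 2 * (y + z) + 4 * (y ^ 2 + y * z + z ^ 2))]

lemma comparison_aux {f f' : ℝ → ℝ} (hc : ContinuousOn f (Set.Icc 0 1)) (h0 : f 0 ≤ 0)
    (hd : ∀ t ∈ Set.Ioo (0:ℝ) 1, HasDerivAt f (f' t) t)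
    (hn : ∀ t ∈ Set.Ioo (0:ℝ) 1, 0 ≤ f t → f' t ≤ 0) :
    ∀ t ∈ Set.Icc (0:ℝ) 1, f t ≤ 0 := by
  intro T hT
  by_contra! hpos
  have hcT : ContinuousOn f (Set.Icc 0 T) := hc.mono (Set.Icc_subset_Icc_right hT.2)
  set S := Set.Icc 0 T ∩ f ⁻¹' Set.Iic 0 with hS
  have hScl : IsClosed S := hcT.preimage_isClosed_of_isClosed isClosed_Icc isClosed_Iic
  have hSne : S.Nonempty := ⟨0, ⟨le_refl _, hT.1⟩, h0⟩
  have hSbd : BddAbove S := ⟨T, fun x hx => hx.1.2⟩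
  have hmem : sSup S ∈ S := hScl.csSup_mem hSne hSbd
  set s := sSup S
  have hs0 : f s ≤ 0 := hmem.2
  have hlt : ∀ t ∈ Set.Ioo s T, 0 < f t := by
    intro t ht
    by_contra! hle
    have : t ∈ S := ⟨⟨hmem.1.1.trans ht.1.le, ht.2.le⟩, hle⟩
    exact absurd (le_csSup hSbd this) (not_le.2 ht.1)
  have hsub : ∀ t ∈ Set.Ioo s T, t ∈ Set.Ioo (0:ℝ) 1 := fun t ht =>
    ⟨lt_of_le_of_lt hmem.1.1 ht.1, lt_of_lt_of_le ht.2 hT.2⟩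
  have := anti_aux (f := f) (f' := f') hmem.1.2
    (hcT.mono (Set.Icc_subset_Icc_left hmem.1.1)) (fun t ht => hd t (hsub t ht))
    (fun t ht => hn t (hsub t ht) (hlt t ht).le)
  linarith

/-- mean of `PP` along the cubic, divided by `x` -/
def hh (x : ℝ) : ℝ :=
  ((1309/2500)/4 - (17/250)*x) + 2*x*((1309/2500)^2/7 - (1309/2500)*(17/250)*x/2 + (17/250)^2*x^2)
  + 4*x^2*((1309/2500)^3/10 - 3*(1309/2500)^2*(17/250)*x/7 + 3*(1309/2500)*(17/250)^2*x^2/4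
    - (17/250)^3*x^3)

lemma hh_bounds {x : ℝ} (h0 : 0 ≤ x) (h1 : x ≤ 1) :
    0.1309 + 0.0103 * x ≤ hh x ∧ hh x ≤ 0.2 := by
  have e2 : x^2 ≤ x := by nlinarith
  have p2 : 0 ≤ x^2 := by positivity
  have p3 : 0 ≤ x^3 := by positivity
  have p4 : 0 ≤ x^4 := by positivity
  have p5 : 0 ≤ x^5 := by positivity
  have e3 : x^3 ≤ x^2 := by nlinarith
  have e4 : x^4 ≤ x^3 := by nlinarith
  have e5 : x^5 ≤ x^4 := by nlinarith
  unfold hh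
  constructor <;> ring_nf <;> nlinarith

lemma key_poly {x : ℝ} (h0 : 0 ≤ x) (h1 : x ≤ 1) :
    6 * (17/250) ≤ 3 * (1309/2500) * (2 * (0.999 * hh x) - x * (0.999 * hh x) ^ 2) := by
  obtain ⟨ha, hb⟩ := hh_bounds h0 h1
  set H := 0.999 * hh x with hH
  have hL : 0.1307 + 0.0102 * x ≤ H := by rw [hH]; nlinarith
  have hU : H ≤ 0.2 := by rw [hH]; nlinarith
  set L := 0.1307 + 0.0102 * x with hLd
  have hL1 : L ≤ 0.2 := by linarith
  have hL0 : 0 ≤ L := by rw [hLd]; nlinarith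
  have h2 : 0 ≤ (H - L) * (2 - x * (H + L)) := by
    apply mul_nonneg (by linarith)
    nlinarith
  have h3 : 6 * (17/250) ≤ 3 * (1309/2500) * (2 * L - x * L ^ 2) := by
    have e2 : x^2 ≤ x := by nlinarith
    have e3 : x^3 ≤ x := by nlinarith
    rw [hLd]; ring_nf; nlinarith
  nlinarith

/-- polynomial majorant of the loss integrand -/
def QQ (x : ℝ) : ℝ :=
  (3243/5000)*x^1 + (6113/10000)*x^2 + (69/125)*x^3 + (99/200)*x^4 + (4433/10000)*x^5
  + (397/1000)*x^6 + (711/2000)*x^7 + (3183/10000)*x^8 + (57/200)*x^9 + (319/1250)*x^10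
  + (457/2000)*x^11 + (1023/5000)*x^12 + (229/1250)*x^13 + (1641/10000)*x^14 + (351/250)*x^15

lemma QQ_bound {x : ℝ} (h0 : 0 ≤ x) (h1 : x ≤ 1) :
    (1309/2500)*x - (17/250)*x^2 + x/8 ≤ QQ x * (1 - 2*((1309/2500)*x - (17/250)*x^2)) := by
  have key : QQ x * (1 - 2*((1309/2500)*x - (17/250)*x^2))
      - ((1309/2500)*x - (17/250)*x^2 + x/8) =
    (269/3125000)*x^2 + (703/12500000)*x^3 + (103/1250000)*x^4 + (1/125000)*x^5
    + (1203/12500000)*x^6 + (63/1250000)*x^7 + (31/2500000)*x^8 + (303/12500000)*x^9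
    + (23/625000)*x^10 + (91/6250000)*x^11 + (11/500000)*x^12 + (59/3125000)*x^13
    + (491/6250000)*x^14
    + x^15*((351/250)*(1-2*(1309/2500)*x+2*(17/250)*x^2) - (1836629/12500000)
      - (-27897/1250000)*x) := by
    unfold QQ; ring
  have hq : 0 ≤ (351/250)*(1-2*(1309/2500)*x+2*(17/250)*x^2) - (1836629/12500000)
      - (-27897/1250000)*x := by nlinarith
  have : 0 ≤ QQ x * (1 - 2*((1309/2500)*x - (17/250)*x^2))
      - ((1309/2500)*x - (17/250)*x^2 + x/8) := by
    rw [key]; positivity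
  linarith

def GG (t : ℝ) : ℝ :=
  (3243/5000)*(t^4/4) + (6113/10000)*(t^7/7) + (69/125)*(t^10/10) + (99/200)*(t^13/13)
  + (4433/10000)*(t^16/16)
  + (397/1000)*(t^19/19) + (711/2000)*(t^22/22) + (3183/10000)*(t^25/25) + (57/200)*(t^28/28)
  + (319/1250)*(t^31/31)
  + (457/2000)*(t^34/34) + (1023/5000)*(t^37/37) + (229/1250)*(t^40/40)
  + (1641/10000)*(t^43/43) + (351/250)*(t^46/46)

lemma pow_deriv_aux (n : ℕ) (t : ℝ) :
    HasDerivAt (fun t : ℝ => t ^ (n + 1) / ((n + 1 : ℕ) : ℝ)) (t ^ n) t := by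
  have h := (hasDerivAt_pow (n + 1) t).div_const ((n + 1 : ℕ) : ℝ)
  refine hd_congr h (fun s => rfl) ?_
  have : ((n + 1 : ℕ) : ℝ) ≠ 0 := by positivity
  rw [Nat.add_sub_cancel, mul_div_cancel_left₀ _ this]

lemma pow_deriv_aux' (n m : ℕ) (c k t : ℝ) (hm : m = n + 1) (hk : k = (m : ℝ)) :
    HasDerivAt (fun t : ℝ => c * (t ^ m / k)) (c * t ^ n) t := by
  subst hm; subst hk
  exact (pow_deriv_aux n t).const_mul c

lemma GG_deriv (t : ℝ) : HasDerivAt GG (QQ (t^3)) t := by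
  have h := ((((((((((((((pow_deriv_aux' 3 4 (3243/5000) 4 t (by norm_num) (by norm_num)).add
    (pow_deriv_aux' 6 7 (6113/10000) 7 t (by norm_num) (by norm_num))).add
    (pow_deriv_aux' 9 10 (69/125) 10 t (by norm_num) (by norm_num))).add
    (pow_deriv_aux' 12 13 (99/200) 13 t (by norm_num) (by norm_num))).add
    (pow_deriv_aux' 15 16 (4433/10000) 16 t (by norm_num) (by norm_num))).add
    (pow_deriv_aux' 18 19 (397/1000) 19 t (by norm_num) (by norm_num))).add
    (pow_deriv_aux' 21 22 (711/2000) 22 t (by norm_num) (by norm_num))).add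
    (pow_deriv_aux' 24 25 (3183/10000) 25 t (by norm_num) (by norm_num))).add
    (pow_deriv_aux' 27 28 (57/200) 28 t (by norm_num) (by norm_num))).add
    (pow_deriv_aux' 30 31 (319/1250) 31 t (by norm_num) (by norm_num))).add
    (pow_deriv_aux' 33 34 (457/2000) 34 t (by norm_num) (by norm_num))).add
    (pow_deriv_aux' 36 37 (1023/5000) 37 t (by norm_num) (by norm_num))).add
    (pow_deriv_aux' 39 40 (229/1250) 40 t (by norm_num) (by norm_num))).add
    (pow_deriv_aux' 42 43 (1641/10000) 43 t (by norm_num) (by norm_num))).add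
    (pow_deriv_aux' 45 46 (351/250) 46 t (by norm_num) (by norm_num))
  have e : QQ (t^3) = (3243/5000)*t^3 + (6113/10000)*t^6 + (69/125)*t^9 + (99/200)*t^12
    + (4433/10000)*t^15
    + (397/1000)*t^18 + (711/2000)*t^21 + (3183/10000)*t^24 + (57/200)*t^27 + (319/1250)*t^30
    + (457/2000)*t^33 + (1023/5000)*t^36 + (229/1250)*t^39 + (1641/10000)*t^42
    + (351/250)*t^45 := by unfold QQ; ring
  rw [e]
  exact h

/-- antiderivative of `PP (α s³ - d)` -/
def KK (d s : ℝ) : ℝ :=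
  ((1309/2500)*(s^4/4) - d*s)
  + 2*((1309/2500)^2*(s^7/7) - (1309/2500)*d*(s^4/2) + d^2*s)
  + 4*((1309/2500)^3*(s^10/10) - 3*(1309/2500)^2*d*(s^7/7) + 3*(1309/2500)*d^2*(s^4/4) - d^3*s)

lemma KK_deriv (d t : ℝ) : HasDerivAt (KK d) (PP ((1309/2500)*t^3 - d)) t := by
  have h4 := pow_deriv_aux' 3 4 1 4 t (by norm_num) (by norm_num)
  have h7 := pow_deriv_aux' 6 7 1 7 t (by norm_num) (by norm_num)
  have h10 := pow_deriv_aux' 9 10 1 10 t (by norm_num) (by norm_num)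
  have h := (((h4.const_mul ((1309/2500) - 4*(1309/2500)*d + 12*(1309/2500)*d^2)).add
    (h7.const_mul (2*(1309/2500)^2 - 12*(1309/2500)^2*d))).add
    (h10.const_mul (4*(1309/2500)^3))).add
    ((hasDerivAt_id t).const_mul (-d + 2*d^2 - 4*d^3))
  refine hd_congr h (fun s => ?_) ?_
  · simp only [KK, Pi.add_apply, id]
    ring
  · unfold PP; ring

theorem core (g M g' M' : ℝ → ℝ)
    (hgc : ContinuousOn g (Set.Icc 0 1)) (hMc : ContinuousOn M (Set.Icc 0 1))
    (g0 : g 0 = 0) (M0 : M 0 = 0)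
    (hg : ∀ t ∈ Set.Ioo (0:ℝ) 1, HasDerivAt g (g' t) t)
    (hM : ∀ t ∈ Set.Ioo (0:ℝ) 1, HasDerivAt M (M' t) t)
    (hgt : ∀ t ∈ Set.Ioo (0:ℝ) 1, g t ≤ t)
    (hM1 : ∀ t ∈ Set.Ioo (0:ℝ) 1, M' t ≤ 3*(1309/2500) * (max (g t) 0)^2)
    (hup : ∀ t ∈ Set.Ioo (0:ℝ) 1, g' t ≤ 1 - 0.999 * PP (M t))
    (hlo : ∀ t ∈ Set.Ioo (0:ℝ) 1, M t < 1/2 → 0.999 - (M t + t^3/8) / (1 - 2 * M t) ≤ g' t) :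
    1/2 ≤ g 1 := by
  have hbar : ∀ t ∈ Set.Icc (0:ℝ) 1, M t - ((1309/2500)*t^3 - (17/250)*t^6) ≤ 0 := by
    apply comparison_aux (f' := fun t => M' t - ((1309/2500)*(3*t^2) - (17/250)*(6*t^5)))
    · exact hMc.sub (by fun_prop)
    · simp [M0]
    · intro t ht
      apply (hM t ht).sub
      have h3 := (hasDerivAt_pow 3 t).const_mul (1309/2500 : ℝ)
      have h6 := (hasDerivAt_pow 6 t).const_mul (17/250 : ℝ)
      exact hd_congr (h3.sub h6) (fun s => rfl) (by norm_num)
    · intro T hT hge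
      have hT0 := hT.1
      have hT1 := hT.2
      -- lower bound on M before T
      have hlow : ∀ s ∈ Set.Ioo 0 T, (1309/2500)*s^3 - (17/250)*T^6 ≤ M s := by
        intro s hs
        have h := anti_aux (f := fun t => M t - (1309/2500)*t^3)
          (f' := fun t => M' t - (1309/2500)*(3*t^2)) hs.2.le
          ((hMc.mono (Set.Icc_subset_Icc hs.1.le hT1.le)).sub (by fun_prop))
          (fun t ht => by
            have h3 := (hasDerivAt_pow 3 t).const_mul (1309/2500 : ℝ)
            have hm := hM t ⟨hs.1.trans ht.1, ht.2.trans hT1⟩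
            exact hd_congr (hm.sub h3) (fun s => rfl) (by norm_num))
          (fun t ht => by
            have ht' : t ∈ Set.Ioo (0:ℝ) 1 := ⟨hs.1.trans ht.1, ht.2.trans hT1⟩
            have h1 := hM1 t ht'
            have h2 : max (g t) 0 ≤ t := max_le (hgt t ht') ht'.1.le
            have h3 : (max (g t) 0)^2 ≤ t^2 := pow_le_pow_left₀ (le_max_right _ _) h2 2
            linarith)
        linarith
      have hgT : g T ≤ T - 0.999 * KK ((17/250)*T^6) T := by
        have h := anti_aux (f := fun t => g t - t + 0.999 * KK ((17/250)*T^6) t)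
          (f' := fun t => g' t - 1 + 0.999 * PP ((1309/2500)*t^3 - (17/250)*T^6)) hT0.le
          (((hgc.mono (Set.Icc_subset_Icc_right hT1.le)).sub (by fun_prop)).add
            (by unfold KK; fun_prop))
          (fun t ht => ((hg t ⟨ht.1, ht.2.trans hT1⟩).sub (hasDerivAt_id t)).add
            ((KK_deriv _ t).const_mul _))
          (fun t ht => by
            have h1 := hup t ⟨ht.1, ht.2.trans hT1⟩
            have h2 := PP_mono (hlow t ht)
            linarith)
        have hk0 : KK ((17/250)*T^6) 0 = 0 := by unfold KK; ring
        simp only [hk0, g0] at h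
        linarith
      have hx0 : 0 ≤ T^3 := by positivity
      have hx1 : T^3 ≤ 1 := pow_le_one₀ hT0.le hT1.le
      have hK : KK ((17/250)*T^6) T = T * (T^3 * hh (T^3)) := by
        unfold KK hh; ring
      have hkey := key_poly hx0 hx1
      obtain ⟨ha, hb⟩ := hh_bounds hx0 hx1
      rw [hK] at hgT
      set x := T^3 with hx
      set H := 0.999 * hh x with hH
      have hH0 : 0 ≤ H := by rw [hH]; nlinarith
      have hH1 : H ≤ 1 := by rw [hH]; nlinarith
      have hg2 : g T ≤ T * (1 - x * H) := by rw [hH]; linarith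
      have hxH : 0 ≤ 1 - x * H := by nlinarith
      have h2 : max (g T) 0 ≤ T * (1 - x*H) := max_le hg2 (mul_nonneg hT0.le hxH)
      have h3 : (max (g T) 0)^2 ≤ (T * (1 - x*H))^2 := pow_le_pow_left₀ (le_max_right _ _) h2 2
      have h1 := hM1 T hT
      have h5 : T^5 = T^2 * x := by rw [hx]; ring
      rw [h5]
      have h6 : 0 ≤ (T^2 * x) * (3 * (1309/2500) * (2 * H - x * H ^ 2) - 6 * (17/250)) :=
        mul_nonneg (by positivity) (by linarith)
      nlinarith
  have hfin := anti_aux (f := fun t => 0.999 * t - GG t - g t)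
    (f' := fun t => 0.999 * 1 - QQ (t^3) - g' t) zero_le_one
    (ContinuousOn.sub (by unfold GG; fun_prop) hgc)
    (fun t ht => (((hasDerivAt_id t).const_mul _).sub (GG_deriv t)).sub (hg t ht))
    (fun t ht => by
      have hb := hbar t ⟨ht.1.le, ht.2.le⟩
      have hx0 : 0 ≤ t^3 := pow_nonneg ht.1.le 3
      have hx1 : t^3 ≤ 1 := pow_le_one₀ ht.1.le ht.2.le
      have hQ := QQ_bound hx0 hx1
      have h6 : t^6 = (t^3)^2 := by ring
      rw [h6] at hb
      set x := t^3 with hx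
      have hQ0 : 0 ≤ QQ x := by unfold QQ; positivity
      have hMb : (1309/2500)*x - (17/250)*x^2 < 1/2 := by nlinarith
      have hMt : M t < 1/2 := by linarith
      have h1 := hlo t ht hMt
      have h2 : (M t + x/8) / (1 - 2 * M t) ≤ QQ x := by
        rw [div_le_iff₀ (by linarith)]
        nlinarith
      linarith)
  have e0 : GG 0 = 0 := by unfold GG; norm_num
  have e1 : GG 1 ≤ 0.499 := by unfold GG; norm_num
  simp only [e0, g0] at hfin
  linarith

section shell
variable {R₀ L₀ C₁ C₂ q : ℝ} {μ : ℝ → ℝ}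

lemma gam_hasDerivAt (hL : 0 < L₀) (hR : 0 < R₀) (h : IsReducedShell R₀ L₀ C₁ C₂ q μ)
    {r : ℝ} (hr : R₀ ≤ r) : HasDerivAt (gam L₀ μ) (gamder R₀ L₀ C₁ C₂ q μ r) r := by
  have hr0 : 0 < r := hR.trans_le hr
  have h1 := h.field_eq r hr
  have h2 : HasDerivAt (fun r : ℝ => 1 + L₀ / r ^ 2) (L₀ * (-(2 * r) / (r ^ 2) ^ 2)) r := by
    have := ((hasDerivAt_pow 2 r).inv (by positivity)).const_mul L₀
    have h3 := this.const_add 1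
    refine hd_congr h3 (fun s => ?_) ?_
    · simp [div_eq_mul_inv]
    · norm_num
  have h4 := h2.log (by positivity)
  have h5 := h1.neg.sub (h4.const_mul (1/2))
  refine hd_congr h5 (fun s => rfl) ?_
  unfold gamder
  field_simp
  ring

lemma gam_cont (hL : 0 < L₀) (hR : 0 < R₀) (h : IsReducedShell R₀ L₀ C₁ C₂ q μ) :
    ContinuousOn (gam L₀ μ) (Set.Ici R₀) := fun _ hr =>
  (gam_hasDerivAt hL hR h hr).continuousAt.continuousWithinAt

lemma integrand_cont (hL : 0 < L₀) (hR : 0 < R₀) (hq : 2 ≤ q)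
    (h : IsReducedShell R₀ L₀ C₁ C₂ q μ) :
    ContinuousOn (fun η => 4 * π * η ^ 2 * rho L₀ C₁ q μ η) (Set.Ici R₀) := by
  unfold rho
  have hg := gam_cont hL hR h
  have h1 : ContinuousOn (fun η => (max (gam L₀ μ η) 0) ^ q) (Set.Ici R₀) :=
    (hg.sup continuousOn_const).rpow_const (fun x _ => Or.inr (by linarith))
  apply ContinuousOn.mul (by fun_prop)
  apply ContinuousOn.div (continuousOn_const.mul h1) (by fun_prop)
  intro x hx
  have : 0 < x := hR.trans_le hx
  positivity

lemma integrand_nonneg (hC₁ : 0 < C₁) (η : ℝ) :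
    0 ≤ 4 * π * η ^ 2 * rho L₀ C₁ q μ η := by
  unfold rho
  have := Real.rpow_nonneg (le_max_right (gam L₀ μ η) 0) q
  have := Real.pi_pos
  positivity

lemma mass_nonneg (hC₁ : 0 < C₁) {r : ℝ} (hr : R₀ ≤ r) : 0 ≤ mass R₀ L₀ C₁ q μ r :=
  intervalIntegral.integral_nonneg hr (fun η _ => integrand_nonneg hC₁ η)

lemma integrand_intble (hL : 0 < L₀) (hR : 0 < R₀) (hq : 2 ≤ q)
    (h : IsReducedShell R₀ L₀ C₁ C₂ q μ) {r : ℝ} (hr : R₀ ≤ r) :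
    IntervalIntegrable (fun η => 4 * π * η ^ 2 * rho L₀ C₁ q μ η) volume R₀ r := by
  apply ContinuousOn.intervalIntegrable
  rw [Set.uIcc_of_le hr]
  exact (integrand_cont hL hR hq h).mono Set.Icc_subset_Ici_self

lemma mass_hasDerivAt (hL : 0 < L₀) (hR : 0 < R₀) (hq : 2 ≤ q)
    (h : IsReducedShell R₀ L₀ C₁ C₂ q μ) {r : ℝ} (hr : R₀ < r) :
    HasDerivAt (mass R₀ L₀ C₁ q μ) (4 * π * r ^ 2 * rho L₀ C₁ q μ r) r := by
  have hc := (integrand_cont hL hR hq h).mono Set.Ioi_subset_Ici_self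
  exact intervalIntegral.integral_hasDerivAt_right (integrand_intble hL hR hq h hr.le)
    (hc.stronglyMeasurableAtFilter isOpen_Ioi r hr)
    (hc.continuousAt (isOpen_Ioi.mem_nhds hr))

lemma mass_cont (hL : 0 < L₀) (hR : 0 < R₀) (hq : 2 ≤ q)
    (h : IsReducedShell R₀ L₀ C₁ C₂ q μ) {b : ℝ} (hb : R₀ ≤ b) :
    ContinuousOn (mass R₀ L₀ C₁ q μ) (Set.Icc R₀ b) := by
  have hi := (intervalIntegrable_iff_integrableOn_Icc_of_le hb).1 (integrand_intble hL hR hq h hb)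
  have := intervalIntegral.continuousOn_primitive_interval (a := R₀) (b := b)
    (by rwa [Set.uIcc_of_le hb])
  rwa [Set.uIcc_of_le hb] at this

lemma pres_nonneg (hC₂ : 0 < C₂) (r : ℝ) : 0 ≤ pres L₀ C₂ q μ r := by
  unfold pres
  have := Real.rpow_nonneg (le_max_right (gam L₀ μ r) 0) (q+1)
  positivity

lemma muder_nonneg (hR : 0 < R₀) (hC₁ : 0 < C₁) (hC₂ : 0 < C₂)
    (h : IsReducedShell R₀ L₀ C₁ C₂ q μ) {r : ℝ} (hr : R₀ ≤ r) :
    0 ≤ muder R₀ L₀ C₁ C₂ q μ r := by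
  unfold muder
  have hr0 : 0 < r := hR.trans_le hr
  have h1 := mass_nonneg (L₀ := L₀) (q := q) (μ := μ) hC₁ hr
  have h2 := pres_nonneg (L₀ := L₀) (q := q) (μ := μ) hC₂ r
  have h3 : 0 < 1 - 2 * mass R₀ L₀ C₁ q μ r / r := by linarith [h.mass_lt r hr]
  have := Real.pi_pos
  positivity

lemma gam_upper (hL : 0 < L₀) (hR : 0 < R₀) (hC₁ : 0 < C₁) (hC₂ : 0 < C₂)
    (h : IsReducedShell R₀ L₀ C₁ C₂ q μ) {r : ℝ} (hr : R₀ ≤ r) :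
    gam L₀ μ r ≤ (r - R₀) / R₀ := by
  have := anti_aux (f := fun s => gam L₀ μ s - (s - R₀) / R₀)
    (f' := fun s => gamder R₀ L₀ C₁ C₂ q μ s - 1 / R₀) hr
    (((gam_cont hL hR h).mono Set.Icc_subset_Ici_self).sub (by fun_prop))
    (fun t ht => (gam_hasDerivAt hL hR h ht.1.le).sub
      (((hasDerivAt_id t).sub_const R₀).div_const R₀))
    (fun t ht => by
      have h1 := muder_nonneg hR hC₁ hC₂ h ht.1.le
      have ht0 : 0 < t := hR.trans ht.1
      have h2 : L₀ / (t * (t ^ 2 + L₀)) ≤ 1 / R₀ := by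
        rw [div_le_div_iff₀ (by positivity) hR]
        have : R₀ < t := ht.1
        nlinarith [pow_pos ht0 3]
      unfold gamder
      linarith)
  rw [h.inner_zero] at this
  simp only [sub_self, zero_div] at this
  linarith

lemma E_bound {R σ C q : ℝ} (hR : 0 < R) (hσ : 0 < σ) (hC : 1 ≤ C) (hq : 2 ≤ q)
    (h : σ ≤ R ^ ((q + 3) / (q + 1)) / (C * (8 : ℝ) ^ (1 / (q + 1)))) :
    (σ / R) ^ (q + 1) * C ≤ R ^ 2 / 8 := by
  have hq1 : 0 < q + 1 := by linarith
  have h1 := Real.rpow_le_rpow hσ.le h hq1.le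
  rw [Real.div_rpow (by positivity) (by positivity), Real.mul_rpow (by positivity) (by positivity),
    ← Real.rpow_mul hR.le, ← Real.rpow_mul (by norm_num), div_mul_cancel₀ _ hq1.ne',
    one_div_mul_cancel hq1.ne', Real.rpow_one] at h1
  have h2 : R ^ (q + 3) = R ^ (q + 1) * R ^ 2 := by
    rw [← Real.rpow_natCast R 2, ← Real.rpow_add hR]; norm_num; ring_nf
  have h3 : C ≤ C ^ (q + 1) := by
    conv_lhs => rw [← Real.rpow_one C]
    exact Real.rpow_le_rpow_of_exponent_le hC (by linarith)
  rw [Real.div_rpow hσ.le hR.le]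
  have hRq : 0 < R ^ (q + 1) := by positivity
  have hCq : 0 < C ^ (q + 1) := by positivity
  rw [h2, le_div_iff₀ (by positivity)] at h1
  rw [div_mul_eq_mul_div, div_le_div_iff₀ hRq (by norm_num)]
  have h4 : 0 ≤ σ ^ (q + 1) := by positivity
  nlinarith [mul_le_mul_of_nonneg_left h3 h4]

set_option maxHeartbeats 4000000 in
theorem shell_main (hL : 0 < L₀) (hC₁ : 0 < C₁) (hC₂ : 0 < C₂) (hq : 2 ≤ q)
    (hR : 0 < R₀) (h : IsReducedShell R₀ L₀ C₁ C₂ q μ) {σ : ℝ} (hσ : 0 < σ)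
    (hE1 : (σ / R₀) ^ (q + 1) * C₁ ≤ R₀ ^ 2 / 8)
    (hE2 : (σ / R₀) ^ (q + 1) * (4 * π * C₂) ≤ R₀ ^ 2 / 8)
    (hs : σ / R₀ ≤ 0.0001) (hRL : R₀ ^ 2 ≤ 0.0001 * L₀) :
    1 / 2 ≤ R₀ / σ * gam L₀ μ (R₀ + σ) := by
  have hpi := Real.pi_pos
  have hσR : σ ≤ 0.0001 * R₀ := by rwa [div_le_iff₀ hR] at hs
  set E := (σ / R₀) ^ (q + 1) with hE
  have hE0 : 0 ≤ E := by positivity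
  have hlin : ∀ t : ℝ, HasDerivAt (fun t => R₀ + σ * t) σ t := fun t =>
    hd_congr (((hasDerivAt_id t).const_mul σ).const_add R₀) (fun s => rfl) (by simp)
  -- bounds for g
  have hgt : ∀ t ∈ Set.Ioo (0:ℝ) 1, R₀ / σ * gam L₀ μ (R₀ + σ * t) ≤ t := by
    intro t ht
    have h1 := gam_upper hL hR hC₁ hC₂ h (r := R₀ + σ * t)
      (by nlinarith [mul_pos hσ ht.1])
    have : (R₀ + σ * t - R₀) / R₀ = σ / R₀ * t := by field_simp; ring
    rw [this] at h1
    calc R₀ / σ * gam L₀ μ (R₀ + σ * t) ≤ R₀ / σ * (σ / R₀ * t) := by gcongr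
      _ = t := by field_simp
  have hgmax : ∀ t, max (gam L₀ μ (R₀ + σ * t)) 0 =
      σ / R₀ * max (R₀ / σ * gam L₀ μ (R₀ + σ * t)) 0 := by
    intro t
    rw [mul_max_of_nonneg _ _ (by positivity)]
    congr 1
    · field_simp
    · simp
  have hmaps : Set.MapsTo (fun t => R₀ + σ * t) (Set.Icc 0 1) (Set.Icc R₀ (R₀ + σ)) := by
    intro t ht
    exact ⟨by nlinarith [mul_nonneg hσ.le ht.1], by nlinarith [mul_le_mul_of_nonneg_left ht.2 hσ.le]⟩
  have hpow1 : (σ / R₀) ^ q * σ = E * R₀ := by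
    rw [hE, Real.rpow_add (by positivity), Real.rpow_one]; field_simp
  have key := core (fun t => R₀ / σ * gam L₀ μ (R₀ + σ * t))
    (fun t => mass R₀ L₀ C₁ q μ (R₀ + σ * t) / R₀)
    (fun t => R₀ * gamder R₀ L₀ C₁ C₂ q μ (R₀ + σ * t))
    (fun t => (4 * π * (R₀ + σ * t) ^ 2 * rho L₀ C₁ q μ (R₀ + σ * t)) * σ / R₀)
    (continuousOn_const.mul (((gam_cont hL hR h).mono Set.Icc_subset_Ici_self).comp
      (by fun_prop) hmaps))
    (((mass_cont hL hR hq h (b := R₀ + σ) (by linarith)).comp (by fun_prop) hmaps).div_const _)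
    (by simp [h.inner_zero]) (by simp [mass])
    (fun t ht => by
      have hr : R₀ ≤ R₀ + σ * t := by nlinarith [mul_pos hσ ht.1]
      have h1 := ((gam_hasDerivAt hL hR h hr).comp t (hlin t)).const_mul (R₀ / σ)
      exact hd_congr h1 (fun s => rfl) (by field_simp))
    (fun t ht => by
      have hr : R₀ < R₀ + σ * t := by nlinarith [mul_pos hσ ht.1]
      exact ((mass_hasDerivAt hL hR hq h hr).comp t (hlin t)).div_const R₀)
    hgt
    (fun t ht => by
      have hg1 := hgt t ht
      have hm := hgmax t
      have hr : R₀ ≤ R₀ + σ * t := by nlinarith [mul_pos hσ ht.1]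
      beta_reduce
      unfold rho
      rw [hm]
      set r := R₀ + σ * t
      set G := max (R₀ / σ * gam L₀ μ r) 0
      have hG0 : 0 ≤ G := le_max_right _ _
      have hG1 : G ≤ 1 := max_le (hg1.trans ht.2.le) zero_le_one
      have hr0 : 0 < r := hR.trans_le hr
      have hGq : G ^ q ≤ G ^ 2 := by
        rw [← Real.rpow_natCast G 2]
        exact Real.rpow_le_rpow_of_exponent_ge' hG0 hG1 (by norm_num) (by exact_mod_cast hq)
      have hGq0 : 0 ≤ G ^ q := by positivity
      rw [Real.mul_rpow (by positivity) hG0]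
      have e : 4 * π * r ^ 2 * (C₁ * ((σ / R₀) ^ q * G ^ q) / r ^ 4) * σ / R₀ =
          4 * π * (E * C₁) * G ^ q / r ^ 2 := by
        have : 4 * π * r ^ 2 * (C₁ * ((σ / R₀) ^ q * G ^ q) / r ^ 4) * σ / R₀ =
          4 * π * (((σ / R₀) ^ q * σ) * C₁) * G ^ q / r ^ 2 / R₀ := by
          field_simp
        rw [this, hpow1]; field_simp
      rw [e, div_le_iff₀ (by positivity)]
      have hrr : R₀ ^ 2 ≤ r ^ 2 := by gcongr
      have hpi2 := Real.pi_lt_d4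
      calc 4 * π * (E * C₁) * G ^ q ≤ 4 * π * (R₀ ^ 2 / 8) * G ^ 2 := by gcongr
        _ ≤ 4 * (3 * (1309/2500) * 2) * (R₀ ^ 2 / 8) * G ^ 2 := by
            gcongr; norm_num at hpi2 ⊢; linarith
        _ = 3 * (1309/2500) * G ^ 2 * R₀ ^ 2 := by ring
        _ ≤ _ := by gcongr)
    (fun t ht => by
      have hr : R₀ ≤ R₀ + σ * t := by nlinarith [mul_pos hσ ht.1]
      have hrub : R₀ + σ * t ≤ 1.0001 * R₀ := by nlinarith [ht.1, ht.2]
      beta_reduce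
      set r := R₀ + σ * t
      have hr0 : 0 < r := hR.trans_le hr
      have hm := mass_nonneg (L₀ := L₀) (q := q) (μ := μ) hC₁ hr
      have hp := pres_nonneg (L₀ := L₀) (q := q) (μ := μ) hC₂ r
      have hlt := h.mass_lt r hr
      unfold gamder muder
      set m := mass R₀ L₀ C₁ q μ r
      have h1 : R₀ * (L₀ / (r * (r ^ 2 + L₀))) ≤ 1 := by
        rw [← mul_div_assoc, div_le_one (by positivity)]
        nlinarith [pow_pos hr0 3]
      set κ := R₀ / r with hκ
      have hκ0 : 0 < κ := by positivity
      have hκ1 : 0.9999 ≤ κ := by rw [hκ, le_div_iff₀ hr0]; nlinarith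
      have hκ2 : κ ≤ 1 := by rw [hκ, div_le_one hr0]; exact hr
      set y := m / r with hy
      have hy0 : 0 ≤ y := by positivity
      have hlt' : 2 * y < 1 := by rw [hy]; rw [← mul_div_assoc]; exact hlt
      have hyM : y = κ * (m / R₀) := by rw [hy, hκ]; field_simp
      have e1 : 2 * m / r = 2 * y := by rw [hy]; ring
      have e2 : R₀ * (m / r ^ 2) = κ * y := by rw [hy, hκ]; field_simp
      have hPy : PP y ≤ y * (1 - 2 * y)⁻¹ := by
        rw [← div_eq_mul_inv, le_div_iff₀ (by linarith)]
        unfold PP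
        nlinarith [pow_nonneg hy0 4]
      have hPM : 0.999 * PP (m / R₀) ≤ κ * PP y := by
        rw [hyM]
        set x := m / R₀
        have hx0 : 0 ≤ x := by positivity
        have k2 : 0.9998 ≤ κ ^ 2 := by nlinarith
        have k3 : 0.9997 ≤ κ ^ 3 := by nlinarith
        have k4 : 0.9996 ≤ κ ^ 4 := by nlinarith
        unfold PP
        have a1 := mul_le_mul_of_nonneg_right k2 hx0
        have a2 := mul_le_mul_of_nonneg_right k3 (pow_nonneg hx0 2)
        have a3 := mul_le_mul_of_nonneg_right k4 (pow_nonneg hx0 3)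
        have := pow_nonneg hx0 2
        have := pow_nonneg hx0 3
        nlinarith
      have hinv : 0 ≤ (1 - 2 * y)⁻¹ := inv_nonneg.2 (by linarith)
      have h3 : κ * (y * (1 - 2 * y)⁻¹) ≤
          R₀ * ((m / r ^ 2 + 4 * π * r * pres L₀ C₂ q μ r) * (1 - 2 * m / r)⁻¹) := by
        rw [e1]
        have : R₀ * ((m / r ^ 2 + 4 * π * r * pres L₀ C₂ q μ r) * (1 - 2 * y)⁻¹) =
          κ * (y * (1 - 2 * y)⁻¹) + R₀ * (4 * π * r * pres L₀ C₂ q μ r) * (1 - 2 * y)⁻¹ := by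
          rw [← mul_assoc κ, ← e2]; ring
        rw [this]
        have : 0 ≤ R₀ * (4 * π * r * pres L₀ C₂ q μ r) * (1 - 2 * y)⁻¹ := by positivity
        linarith
      have h4 : κ * PP y ≤ κ * (y * (1 - 2 * y)⁻¹) := by gcongr
      rw [mul_add, mul_neg]
      linarith)
    (fun t ht => by
      have hg1 := hgt t ht
      have hmx := hgmax t
      have hr : R₀ ≤ R₀ + σ * t := by nlinarith [mul_pos hσ ht.1]
      have hrub : R₀ + σ * t ≤ 1.0001 * R₀ := by nlinarith [ht.1, ht.2]
      beta_reduce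
      intro hMlt
      unfold gamder muder pres
      rw [hmx]
      have hm := mass_nonneg (L₀ := L₀) (q := q) (μ := μ) hC₁ hr
      set r := R₀ + σ * t
      have hr0 : 0 < r := hR.trans_le hr
      set m := mass R₀ L₀ C₁ q μ r
      set G := max (R₀ / σ * gam L₀ μ r) 0
      have hG0 : 0 ≤ G := le_max_right _ _
      have hGt : G ≤ t := max_le hg1 ht.1.le
      have hG1 : G ≤ 1 := hGt.trans ht.2.le
      have hGq : G ^ (q + 1) ≤ t ^ 3 := by
        have : G ^ (q + 1) ≤ G ^ 3 := by
          rw [← Real.rpow_natCast G 3]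
          exact Real.rpow_le_rpow_of_exponent_ge' hG0 hG1 (by norm_num) (by push_cast; linarith)
        exact this.trans (pow_le_pow_left₀ hG0 hGt 3)
      have hGq0 : 0 ≤ G ^ (q + 1) := by positivity
      rw [Real.mul_rpow (by positivity) hG0, ← hE]
      have h1 : 0.999 ≤ R₀ * (L₀ / (r * (r ^ 2 + L₀))) := by
        rw [← mul_div_assoc, le_div_iff₀ (by positivity)]
        have hr2 : r ^ 2 ≤ 0.0002 * L₀ := by nlinarith
        nlinarith [mul_le_mul hrub (by linarith : r ^ 2 + L₀ ≤ 1.0002 * L₀) (by positivity)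
          (by positivity), mul_pos hR hL]
      have hmr : m / r ≤ m / R₀ := by gcongr
      have hM0 : 0 ≤ m / R₀ := by positivity
      have e1 : 2 * m / r = 2 * (m / r) := by ring
      have hinv : (1 - 2 * m / r)⁻¹ ≤ (1 - 2 * (m / R₀))⁻¹ := by
        rw [e1]
        apply inv_anti₀ (by linarith) (by linarith)
      have hinv0 : 0 ≤ (1 - 2 * m / r)⁻¹ := inv_nonneg.2 (by rw [e1]; linarith)
      have h2 : R₀ * (m / r ^ 2) ≤ m / R₀ := by
        rw [← mul_div_assoc, div_le_div_iff₀ (by positivity) hR]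
        nlinarith [mul_le_mul_of_nonneg_left (pow_le_pow_left₀ hR.le hr 2) hm]
      have h3 : R₀ * (4 * π * r * (C₂ * (E * G ^ (q + 1)) / r ^ 4)) ≤ t ^ 3 / 8 := by
        have e3 : R₀ * (4 * π * r * (C₂ * (E * G ^ (q + 1)) / r ^ 4)) =
          R₀ * ((E * (4 * π * C₂)) * G ^ (q + 1)) / r ^ 3 := by field_simp
        rw [e3, div_le_iff₀ (by positivity)]
        have ht0 : 0 ≤ t ^ 3 := pow_nonneg ht.1.le 3
        calc R₀ * ((E * (4 * π * C₂)) * G ^ (q + 1)) ≤ R₀ * (R₀ ^ 2 / 8 * t ^ 3) := by gcongr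
          _ = t ^ 3 / 8 * R₀ ^ 3 := by ring
          _ ≤ _ := by gcongr
      have h4 : R₀ * ((m / r ^ 2 + 4 * π * r * (C₂ * (E * G ^ (q + 1)) / r ^ 4)) *
          (1 - 2 * m / r)⁻¹) ≤ (m / R₀ + t ^ 3 / 8) / (1 - 2 * (m / R₀)) := by
        rw [← mul_assoc, mul_add, div_eq_mul_inv (m / R₀ + t ^ 3 / 8)]
        have ht0 : 0 ≤ t ^ 3 := pow_nonneg ht.1.le 3
        apply mul_le_mul (by linarith) hinv hinv0 (by positivity)
      rw [mul_add, mul_neg]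
      linarith)
  simpa using key

end shell

/-- consequence (25) of Lemma 3 in the paper. With
`C_m = max{1, C₁, 4πC₂}`, there is `δ₀ > 0` depending only on
`L₀, C₁, C₂, q` such that for every reduced static shell with inner radius
`R₀ ≤ δ₀` and every `0 < δ ≤ R₀^((q+3)/(q+1))/(C_m·8^(1/(q+1)))`, one has
`γ(R₀ + σ) ≥ σ/(2(R₀ + σ))` for all `σ ∈ [0, δ]`. -/
theorem gamma_lower_bound (L₀ C₁ C₂ q : ℝ)
    (hL₀ : 0 < L₀) (hC₁ : 0 < C₁) (hC₂ : 0 < C₂) (hq : 2 ≤ q) :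
    ∃ δ₀ : ℝ, 0 < δ₀ ∧
      ∀ (R₀ : ℝ) (μ : ℝ → ℝ), 0 < R₀ → R₀ ≤ δ₀ →
        IsReducedShell R₀ L₀ C₁ C₂ q μ →
        ∀ δ : ℝ, 0 < δ →
          δ ≤ R₀ ^ ((q + 3) / (q + 1)) /
                (max (max 1 C₁) (4 * π * C₂) * (8 : ℝ) ^ (1 / (q + 1))) →
          ∀ σ ∈ Set.Icc (0 : ℝ) δ,
            σ / (2 * (R₀ + σ)) ≤ gam L₀ μ (R₀ + σ) := by
  refine ⟨Real.sqrt (min ((0.0001:ℝ) ^ (q + 1)) (0.0001 * L₀)), by positivity, ?_⟩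
  intro R₀ μ hR hRδ h δ hδ hδle σ hσ
  have hR2 : R₀ ^ 2 ≤ min ((0.0001:ℝ) ^ (q + 1)) (0.0001 * L₀) :=
    (Real.le_sqrt' hR).1 hRδ
  rcases eq_or_lt_of_le hσ.1 with h0 | hpos
  · rw [← h0]
    simp [h.inner_zero]
  have hC : (1:ℝ) ≤ max (max 1 C₁) (4 * π * C₂) := (le_max_left _ _).trans (le_max_left _ _)
  have hE := E_bound hR hpos hC hq (hσ.2.trans hδle)
  have hE0 : 0 ≤ (σ / R₀) ^ (q + 1) := by positivity
  have hE1 : (σ / R₀) ^ (q + 1) * C₁ ≤ R₀ ^ 2 / 8 :=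
    (mul_le_mul_of_nonneg_left ((le_max_right _ _).trans (le_max_left _ _)) hE0).trans hE
  have hE2 : (σ / R₀) ^ (q + 1) * (4 * π * C₂) ≤ R₀ ^ 2 / 8 :=
    (mul_le_mul_of_nonneg_left (le_max_right _ _) hE0).trans hE
  have hs : σ / R₀ ≤ 0.0001 := by
    have h1 : (σ / R₀) ^ (q + 1) ≤ (0.0001:ℝ) ^ (q + 1) := by
      have h2 : (σ / R₀) ^ (q + 1) * 1 ≤ R₀ ^ 2 / 8 :=
        (mul_le_mul_of_nonneg_left hC hE0).trans hE
      have h3 := hR2.trans (min_le_left _ _)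
      have h4 : 0 ≤ R₀ ^ 2 := by positivity
      linarith
    exact (Real.rpow_le_rpow_iff (by positivity) (by norm_num) (by linarith)).1 h1
  have key := shell_main hL₀ hC₁ hC₂ hq hR h hpos hE1 hE2 hs (hR2.trans (min_le_right _ _))
  rw [div_mul_eq_mul_div, div_le_div_iff₀ (by norm_num) hpos] at key
  have hg : 0 ≤ gam L₀ μ (R₀ + σ) := by
    by_contra! hneg
    nlinarith [mul_neg_of_pos_of_neg hR hneg]
  rw [div_le_iff₀ (by positivity)]
  nlinarith [mul_nonneg hpos.le hg]

end
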